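/- arXiv:2408.12019 — 5 statements merged into one kernel-verified Lean document; each statement's English description precedes it below -/
import Mathlib

section
/- Let p be a prime and k ≥ ℓ ≥ 2 with ℓ ≤ n. Then Ind_p(n,k,ℓ) ≤ Θ_n^{(k,ℓ)}. Moreover, if k = ℓ then Ind_p(n,ℓ,ℓ) = Θ_n^{(ℓ,ℓ)}. -/
open Finset

/-- A finite set of nonzero vectors of `ℚ_p^n` is orthogonal if every linear
combination of its elements realizes the equality case of the ultrametric
inequality (here `ℚ_p^n` carries the sup norm, and we compare nonnegative-real
valued norms so that the empty supremum makes sense). -/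
def OrthSet (p : ℕ) [Fact p.Prime] {n : ℕ} (F : Finset (Fin n → ℚ_[p])) : Prop :=
  ∀ lam : (Fin n → ℚ_[p]) → ℚ_[p],
    ‖∑ u ∈ F, lam u • u‖₊ = F.sup fun u => ‖lam u • u‖₊

/-- A finite set `S ⊆ ℚ_p^n \ {0}` is `(k,ℓ)`-orthogonal if every `E ⊆ S` of size
`k` contains an orthogonal subset of size `ℓ`. -/
def OrthKL (p : ℕ) [Fact p.Prime] {n : ℕ} (k ℓ : ℕ)
    (S : Finset (Fin n → ℚ_[p])) : Prop :=
  (0 : Fin n → ℚ_[p]) ∉ S ∧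
    ∀ E ⊆ S, E.card = k → ∃ F ⊆ E, F.card = ℓ ∧ OrthSet p F

/-- `Θ_n^{(k,ℓ)}`: the maximum size of a finite `(k,ℓ)`-orthogonal subset of
`ℚ_p^n \ {0}`. -/
noncomputable def Theta (p : ℕ) [Fact p.Prime] (n k ℓ : ℕ) : ℕ :=
  sSup {m | ∃ S : Finset (Fin n → ℚ_[p]), OrthKL p k ℓ S ∧ S.card = m}
/-- A finite set `S ⊆ F^n \ {0}` is `(k,ℓ)`-independent if every subset `X ⊆ S` of
size `k` spans a subspace of dimension at least `ℓ`. -/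
def IndKL (F : Type*) [Field F] (n k ℓ : ℕ) (S : Finset (Fin n → F)) : Prop :=
  (0 : Fin n → F) ∉ S ∧
    ∀ X ⊆ S, X.card = k →
      ℓ ≤ Module.finrank F ↥(Submodule.span F (↑X : Set (Fin n → F)))

/-- `Ind_q(n,k,ℓ)`: the maximum size of a `(k,ℓ)`-independent subset of
`F^n \ {0}`, where `F` is a field (with `q` elements). -/
noncomputable def IndMax (F : Type*) [Field F] (n k ℓ : ℕ) : ℕ :=
  sSup {m | ∃ S : Finset (Fin n → F), IndKL F n k ℓ S ∧ S.card = m}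

section Reduction

variable {p : ℕ} [Fact p.Prime] {n : ℕ}

/-- The inclusion of `ℤ_p^n` into `ℚ_p^n`. -/
def coeVec (v : Fin n → ℤ_[p]) : Fin n → ℚ_[p] := fun i => v i

/-- Coordinatewise reduction modulo `p`. -/
noncomputable def redVec (v : Fin n → ℤ_[p]) : Fin n → ZMod p :=
  fun i => PadicInt.toZMod (v i)

lemma PadicInt.toZMod_eq_zero_iff_norm_lt_one (x : ℤ_[p]) :
    PadicInt.toZMod x = 0 ↔ ‖x‖ < 1 := by
  rw [← RingHom.mem_ker, PadicInt.ker_toZMod, IsLocalRing.mem_maximalIdeal,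
    PadicInt.mem_nonunits]

lemma coeVec_injective : Function.Injective (coeVec (p := p) (n := n)) := fun _ _ h =>
  funext fun i => Subtype.ext (congrFun h i)

lemma norm_coeVec_le_one (v : Fin n → ℤ_[p]) : ‖coeVec v‖ ≤ 1 :=
  (pi_norm_le_iff_of_nonneg zero_le_one).2 fun i => PadicInt.norm_le_one (v i)

lemma norm_coeVec_lt_one_iff (v : Fin n → ℤ_[p]) : ‖coeVec v‖ < 1 ↔ redVec v = 0 := by
  rw [pi_norm_lt_iff zero_lt_one, funext_iff]
  exact forall_congr' fun i => (PadicInt.toZMod_eq_zero_iff_norm_lt_one (v i)).symm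

lemma norm_coeVec_eq_one {v : Fin n → ℤ_[p]} (h : redVec v ≠ 0) : ‖coeVec v‖ = 1 :=
  le_antisymm (norm_coeVec_le_one v)
    (not_lt.1 fun h' => h ((norm_coeVec_lt_one_iff v).1 h'))

lemma coeVec_sum_smul {ι : Type*} (F : Finset ι) (c : ι → ℤ_[p])
    (v : ι → Fin n → ℤ_[p]) :
    coeVec (∑ u ∈ F, c u • v u) = ∑ u ∈ F, (c u : ℚ_[p]) • coeVec (v u) := by
  ext i
  simp [coeVec, Finset.sum_apply, PadicInt.coe_sum]

lemma redVec_sum_smul {ι : Type*} (F : Finset ι) (c : ι → ℤ_[p])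
    (v : ι → Fin n → ℤ_[p]) :
    redVec (∑ u ∈ F, c u • v u) = ∑ u ∈ F, PadicInt.toZMod (c u) • redVec (v u) := by
  ext i
  simp [redVec, Finset.sum_apply]

lemma redVec_surjective : Function.Surjective (redVec (p := p) (n := n)) := fun x => by
  choose v hv using fun i => ZMod.ringHom_surjective PadicInt.toZMod (x i)
  exact ⟨v, funext hv⟩

/-- Vectors are orthogonal exactly when the reductions of their normalizations are
linearly independent. -/
lemma orthSet_iff_linearIndepOn (F : Finset (Fin n → ℚ_[p]))
    (a : (Fin n → ℚ_[p]) → ℚ_[p]) (v : (Fin n → ℚ_[p]) → Fin n → ℤ_[p])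
    (ha : ∀ u ∈ F, a u ≠ 0) (hv : ∀ u ∈ F, u = a u • coeVec (v u))
    (hr : ∀ u ∈ F, redVec (v u) ≠ 0) :
    OrthSet p F ↔ LinearIndepOn (ZMod p) (fun u => redVec (v u)) (F : Set _) := by
  have hnorm : ∀ u ∈ F, ∀ c : ℚ_[p], ‖c • u‖ = ‖c * a u‖ := fun u hu c => by
    conv_lhs => rw [hv u hu]
    rw [smul_smul, norm_smul, norm_coeVec_eq_one (hr u hu), mul_one]
  constructor
  · intro h
    rw [linearIndepOn_finset_iff]
    intro f hf
    choose c hc using fun u => ZMod.ringHom_surjective PadicInt.toZMod (f u)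
    have key := h fun u => (c u : ℚ_[p]) / a u
    have hsum : ∑ u ∈ F, ((c u : ℚ_[p]) / a u) • u = coeVec (∑ u ∈ F, c u • v u) := by
      rw [coeVec_sum_smul]
      refine Finset.sum_congr rfl fun u hu => ?_
      conv_lhs => rw [hv u hu]
      rw [smul_smul]
      congr 1
      have := hv u hu
      rw [← this, div_mul_cancel₀ _ (ha u hu)]
    have hlt : ‖coeVec (∑ u ∈ F, c u • v u)‖ < 1 := by
      rw [norm_coeVec_lt_one_iff, redVec_sum_smul]
      simpa only [hc] using hf
    intro u hu
    rw [← hc, PadicInt.toZMod_eq_zero_iff_norm_lt_one, PadicInt.norm_def]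
    have h1 : ‖((c u : ℚ_[p]) / a u) • u‖₊ ≤ ‖coeVec (∑ u ∈ F, c u • v u)‖₊ := by
      rw [← hsum, key]
      exact Finset.le_sup (f := fun u => ‖((c u : ℚ_[p]) / a u) • u‖₊) hu
    have h2 : ‖((c u : ℚ_[p]) / a u) • u‖ ≤ ‖coeVec (∑ u ∈ F, c u • v u)‖ := h1
    rw [hnorm u hu, div_mul_cancel₀ _ (ha u hu)] at h2
    exact h2.trans_lt hlt
  · intro h lam
    rcases F.eq_empty_or_nonempty with rfl | hF
    · simp
    obtain ⟨w, hw, hmax⟩ := F.exists_max_image (fun u => ‖lam u • u‖₊) hF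
    have hsup : (F.sup fun u => ‖lam u • u‖₊) = ‖lam w • w‖₊ :=
      le_antisymm (Finset.sup_le hmax) (Finset.le_sup (f := fun u => ‖lam u • u‖₊) hw)
    rw [hsup]
    by_cases h0 : lam w • w = 0
    · have hz : ∀ u ∈ F, lam u • u = 0 := fun u hu => by
        simpa [h0] using hmax u hu
      rw [Finset.sum_eq_zero hz, h0]
    have hM : lam w * a w ≠ 0 := fun h' => h0 <| by
      rw [← norm_eq_zero, hnorm w hw, h', norm_zero]
    have hle : ∀ u ∈ F, ‖lam u * a u / (lam w * a w)‖ ≤ 1 := fun u hu => by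
      rw [norm_div, ← hnorm u hu, ← hnorm w hw]
      exact div_le_one_of_le₀ (hmax u hu) (norm_nonneg _)
    have hd : ∀ u, ∃ d : ℤ_[p], u ∈ F → (d : ℚ_[p]) = lam u * a u / (lam w * a w) :=
      fun u => by
        by_cases hu : u ∈ F
        · exact ⟨⟨_, hle u hu⟩, fun _ => rfl⟩
        · exact ⟨0, fun h' => absurd h' hu⟩
    choose d hd using hd
    have hsum : ∑ u ∈ F, lam u • u = (lam w * a w) • coeVec (∑ u ∈ F, d u • v u) := by
      rw [coeVec_sum_smul, Finset.smul_sum]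
      refine Finset.sum_congr rfl fun u hu => ?_
      rw [hd u hu, smul_smul, mul_div_cancel₀ _ hM, mul_smul, ← hv u hu]
    have hone : d w = 1 := Subtype.ext <| by
      rw [hd w hw, div_self hM, PadicInt.coe_one]
    have hne : redVec (∑ u ∈ F, d u • v u) ≠ 0 := fun h' => by
      rw [redVec_sum_smul] at h'
      have := linearIndepOn_finset_iff.1 h _ h' w hw
      rw [hone, map_one] at this
      exact one_ne_zero this
    rw [← NNReal.coe_inj, coe_nnnorm, coe_nnnorm, hnorm w hw, hsum, norm_smul,
      norm_coeVec_eq_one hne, mul_one]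

lemma exists_normalization (u : Fin n → ℚ_[p]) (hu : u ≠ 0) :
    ∃ (a : ℚ_[p]) (v : Fin n → ℤ_[p]), a ≠ 0 ∧ u = a • coeVec v ∧ redVec v ≠ 0 := by
  obtain ⟨j, hj⟩ := Function.ne_iff.1 hu
  obtain ⟨i, -, hi⟩ := Finset.univ.exists_max_image (fun i => ‖u i‖) ⟨j, Finset.mem_univ j⟩
  have hi0 : u i ≠ 0 := norm_pos_iff.1 <|
    (norm_pos_iff.2 hj).trans_le (hi j (Finset.mem_univ j))
  have hle : ∀ m, ‖u m / u i‖ ≤ 1 := fun m => by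
    rw [norm_div]
    exact div_le_one_of_le₀ (hi m (Finset.mem_univ m)) (norm_nonneg _)
  refine ⟨u i, fun m => ⟨u m / u i, hle m⟩, hi0, ?_, fun h => ?_⟩
  · ext m
    simp [coeVec, mul_div_cancel₀ _ hi0]
  · have h1 : (show ℤ_[p] from ⟨u i / u i, hle i⟩) = 1 := Subtype.ext (div_self hi0)
    have h2 := congrFun h i
    simp [redVec, h1] at h2

variable (p n) in
/-- There is a reduction map to `𝔽_p^n` detecting orthogonality of finite sets of
nonzero vectors. -/
lemma exists_reduction : ∃ r : (Fin n → ℚ_[p]) → Fin n → ZMod p,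
    (∀ u, u ≠ 0 → r u ≠ 0) ∧ ∀ F : Finset (Fin n → ℚ_[p]), 0 ∉ F →
      (OrthSet p F ↔ LinearIndepOn (ZMod p) r (F : Set _)) := by
  have h : ∀ u : Fin n → ℚ_[p], ∃ (a : ℚ_[p]) (v : Fin n → ℤ_[p]),
      u ≠ 0 → a ≠ 0 ∧ u = a • coeVec v ∧ redVec v ≠ 0 := fun u => by
    by_cases hu : u = 0
    · exact ⟨0, 0, fun h => absurd hu h⟩
    · obtain ⟨a, v, h⟩ := exists_normalization u hu
      exact ⟨a, v, fun _ => h⟩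
  choose a v h using h
  refine ⟨fun u => redVec (v u), fun u hu => (h u hu).2.2, fun F hF => ?_⟩
  have hne : ∀ u ∈ F, u ≠ 0 := fun u hu h0 => hF (h0 ▸ hu)
  exact orthSet_iff_linearIndepOn F a v (fun u hu => (h u (hne u hu)).1)
    (fun u hu => (h u (hne u hu)).2.1) fun u hu => (h u (hne u hu)).2.2

variable (p n) in
/-- There is an injective lift from `𝔽_p^n` mapping linearly independent sets to
orthogonal sets. -/
lemma exists_orthogonal_lift : ∃ L : (Fin n → ZMod p) → Fin n → ℚ_[p],
    Function.Injective L ∧ (∀ x, x ≠ 0 → L x ≠ 0) ∧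
      ∀ Y : Finset (Fin n → ZMod p), LinearIndepOn (ZMod p) id (Y : Set (Fin n → ZMod p)) →
        ∀ F : Finset (Fin n → ℚ_[p]),
          (F : Set (Fin n → ℚ_[p])) = L '' (Y : Set (Fin n → ZMod p)) → OrthSet p F := by
  choose s hs using redVec_surjective (p := p) (n := n)
  have hinj : Function.Injective fun x => coeVec (s x) :=
    coeVec_injective.comp (Function.LeftInverse.injective hs)
  refine ⟨fun x => coeVec (s x), hinj, fun x hx h0 => ?_, fun Y hY F hF => ?_⟩
  · apply hx
    rw [← hs x, ← norm_coeVec_lt_one_iff, show coeVec (s x) = 0 from h0, norm_zero]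
    exact zero_lt_one
  · have hinv := Function.leftInverse_invFun hinj
    have hmem : ∀ u ∈ F, ∃ x ∈ Y, coeVec (s x) = u := fun u hu => by
      have : u ∈ (F : Set _) := hu
      rw [hF] at this
      exact this
    refine (orthSet_iff_linearIndepOn F (fun _ => 1)
      (fun u => s (Function.invFun (fun x => coeVec (s x)) u)) (fun _ _ => one_ne_zero)
      (fun u hu => ?_) fun u hu => ?_).2 ?_
    · obtain ⟨x, -, rfl⟩ := hmem u hu
      rw [hinv x, one_smul]
    · obtain ⟨x, hx, rfl⟩ := hmem u hu
      rw [hinv x, hs]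
      exact hY.ne_zero hx
    · rw [hF]
      apply LinearIndepOn.image_of_comp
      convert hY using 1
      funext x
      simp only [Function.comp, hinv x, hs, id]

end Reduction

section Bounds

variable {p : ℕ} [Fact p.Prime] {n k ℓ : ℕ}

lemma OrthKL.card_le (hℓ : 2 ≤ ℓ) {S : Finset (Fin n → ℚ_[p])} (hS : OrthKL p k ℓ S) :
    S.card ≤ Fintype.card (Fin n → ZMod p) * k := by
  classical
  obtain ⟨r, -, hr⟩ := exists_reduction p n
  by_contra! hlt
  obtain ⟨y, -, hy⟩ := Finset.exists_lt_card_fiber_of_mul_lt_card_of_maps_to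
    (f := r) (t := Finset.univ) (fun _ _ => Finset.mem_univ _) hlt
  obtain ⟨E, hE, hEk⟩ := Finset.exists_subset_card_eq hy.le
  have hES : E ⊆ S := hE.trans (Finset.filter_subset _ _)
  obtain ⟨F, hF, hFℓ, hFo⟩ := hS.2 E hES hEk
  obtain ⟨x, hx, z, hz, hxz⟩ := Finset.one_lt_card.1 (show 1 < F.card by omega)
  have hind := (hr F fun h0 => hS.1 (hES (hF h0))).1 hFo
  have hfib : ∀ u ∈ F, r u = y := fun u hu => (Finset.mem_filter.1 (hE (hF hu))).2
  exact hxz (hind.injOn hx hz ((hfib x hx).trans (hfib z hz).symm))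

lemma OrthKL.card_le_theta (hℓ : 2 ≤ ℓ) {S : Finset (Fin n → ℚ_[p])}
    (hS : OrthKL p k ℓ S) : S.card ≤ Theta p n k ℓ :=
  le_csSup ⟨Fintype.card (Fin n → ZMod p) * k, by
    rintro _ ⟨T, hT, rfl⟩; exact hT.card_le hℓ⟩ ⟨S, hS, rfl⟩

lemma IndKL.card_le_indMax {K : Type*} [Field K] [Fintype K] {S : Finset (Fin n → K)}
    (hS : IndKL K n k ℓ S) : S.card ≤ IndMax K n k ℓ := by
  classical
  exact le_csSup ⟨Fintype.card (Fin n → K), by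
    rintro _ ⟨T, -, rfl⟩; exact Finset.card_le_univ T⟩ ⟨S, hS, rfl⟩

variable (p) in
lemma indMax_le_theta (hℓ : 2 ≤ ℓ) : IndMax (ZMod p) n k ℓ ≤ Theta p n k ℓ := by
  classical
  obtain ⟨L, hL, hL0, hLo⟩ := exists_orthogonal_lift p n
  refine csSup_le' ?_
  rintro _ ⟨S, hS, rfl⟩
  rw [← Finset.card_image_of_injective S hL]
  refine OrthKL.card_le_theta hℓ ⟨fun h0 => ?_, fun E hE hEk => ?_⟩
  · obtain ⟨x, hx, hx0⟩ := Finset.mem_image.1 h0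
    exact hL0 x (fun h => hS.1 (h ▸ hx)) hx0
  · obtain ⟨X, hX, rfl⟩ := Finset.subset_image_iff.1 hE
    rw [Finset.card_image_of_injective X hL] at hEk
    obtain ⟨t, htX, htc, -, hti⟩ :=
      Submodule.exists_finset_span_eq_linearIndepOn (ZMod p) (X : Set (Fin n → ZMod p))
    obtain ⟨Y, hY, hYℓ⟩ := Finset.exists_subset_card_eq ((hS.2 X hX hEk).trans_eq htc.symm)
    refine ⟨Y.image L, Finset.image_subset_image (hY.trans (Finset.coe_subset.1 htX)), ?_, ?_⟩
    · rw [Finset.card_image_of_injective Y hL, hYℓ]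
    · exact hLo Y (hti.mono (Finset.coe_subset.2 hY)) _ Finset.coe_image

lemma le_indMax_self (K : Type*) [Field K] [Fintype K] : n ≤ IndMax K n ℓ ℓ := by
  classical
  have hli := (Pi.basisFun K (Fin n)).linearIndependent
  have hS : IndKL K n ℓ ℓ (Finset.univ.image (Pi.basisFun K (Fin n))) := by
    refine ⟨fun h0 => ?_, fun X hX hXℓ => ?_⟩
    · obtain ⟨i, -, hi⟩ := Finset.mem_image.1 h0
      exact hli.ne_zero i hi
    · rw [finrank_span_finset_eq_card, hXℓ]
      refine hli.linearIndepOn_id.mono fun x hx => ?_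
      obtain ⟨i, -, hi⟩ := Finset.mem_image.1 (hX hx)
      exact ⟨i, hi⟩
  simpa [Finset.card_image_of_injective _ hli.injective] using hS.card_le_indMax

lemma theta_self_le_indMax (hℓ : 2 ≤ ℓ) (hℓn : ℓ ≤ n) :
    Theta p n ℓ ℓ ≤ IndMax (ZMod p) n ℓ ℓ := by
  classical
  refine csSup_le' ?_
  rintro _ ⟨S, hS, rfl⟩
  rcases lt_or_ge S.card ℓ with hlt | hge
  · exact hlt.le.trans (hℓn.trans (le_indMax_self (ZMod p)))
  obtain ⟨r, hr0, hr⟩ := exists_reduction p n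
  have hind : ∀ E ⊆ S, E.card = ℓ → LinearIndepOn (ZMod p) r (E : Set _) :=
    fun E hE hEℓ => by
      obtain ⟨F, hF, hFℓ, hFo⟩ := hS.2 E hE hEℓ
      obtain rfl := Finset.eq_of_subset_of_card_le hF (hEℓ.trans hFℓ.symm).le
      exact (hr F fun h0 => hS.1 (hE h0)).1 hFo
  have hinj : Set.InjOn r (S : Set _) := fun x hx y hy hxy => by
    obtain ⟨E, hxyE, hES, hEℓ⟩ := Finset.exists_subsuperset_card_eq
      (s := {x, y}) (t := S) (Finset.insert_subset hx (Finset.singleton_subset_iff.2 hy))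
      (Finset.card_le_two.trans hℓ) hge
    exact (hind E hES hEℓ).injOn (hxyE (by simp)) (hxyE (by simp)) hxy
  rw [← Finset.card_image_of_injOn hinj]
  refine IndKL.card_le_indMax ⟨fun h0 => ?_, fun X hX hXℓ => ?_⟩
  · obtain ⟨u, hu, hu0⟩ := Finset.mem_image.1 h0
    exact hr0 u (fun h => hS.1 (h ▸ hu)) hu0
  · obtain ⟨E, hE, rfl⟩ := Finset.subset_image_iff.1 hX
    have hEinj : Set.InjOn r (E : Set _) := hinj.mono (Finset.coe_subset.2 hE)
    have hEi := (hind E hE (by rwa [Finset.card_image_of_injOn hEinj] at hXℓ)).id_image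
    rw [← Finset.coe_image] at hEi
    rw [finrank_span_finset_eq_card hEi, hXℓ]

end Bounds

theorem stmt4 (p : ℕ) [Fact p.Prime] (n k ℓ : ℕ)
    (hℓ : 2 ≤ ℓ) (hkℓ : ℓ ≤ k) (hℓn : ℓ ≤ n) :
    IndMax (ZMod p) n k ℓ ≤ Theta p n k ℓ ∧
    IndMax (ZMod p) n ℓ ℓ = Theta p n ℓ ℓ :=
  ⟨indMax_le_theta p hℓ, le_antisymm (indMax_le_theta p hℓ) (theta_self_le_indMax hℓ hℓn)⟩
end

section
/- Let q be a prime power, 𝔽_q a finite field with q elements, and 2 ≤ ℓ ≤ k ≤ q^n − 1 with ℓ ≤ n. Then Ind_q(n,k,ℓ) = q^n − 1 if and only if k ≥ q^{ℓ−1}. Equivalently, the set 𝔽_q^n \ {0} itself is (k,ℓ)-independent if and only if k ≥ q^{ℓ−1}. -/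
open Finset

theorem indKL_univ_erase_iff {F : Type*} [Field F] [Fintype F] [DecidableEq F] {n k ℓ : ℕ}
    (hℓ : 1 ≤ ℓ) (hℓn : ℓ ≤ n) :
    IndKL F n k ℓ (univ.erase (0 : Fin n → F)) ↔ Fintype.card F ^ (ℓ - 1) ≤ k := by
  classical
  constructor
  · rintro ⟨-, h⟩
    by_contra! hlt
    let v : Fin (ℓ - 1) → Fin n → F := fun i => Pi.basisFun F (Fin n) (Fin.castLE (by omega) i)
    have hv : LinearIndependent F v :=
      (Pi.basisFun F (Fin n)).linearIndependent.comp _ (Fin.castLE_injective _)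
    let W : Submodule F (Fin n → F) := Submodule.span F (Set.range v)
    have hW : Module.finrank F W = ℓ - 1 := by
      simpa using finrank_span_eq_card hv
    let T : Finset (Fin n → F) := (W : Set (Fin n → F)).toFinset
    have hT : T.card = Fintype.card F ^ (ℓ - 1) := by
      rw [← hW, ← Module.card_eq_pow_finrank, Set.toFinset_card]
      exact Fintype.card_congr (Equiv.refl _)
    have hcard : k ≤ (T.erase 0).card := by
      rw [card_erase_of_mem (by simp [T]), hT]
      omega
    obtain ⟨X, hXT, hX⟩ := exists_subset_card_eq hcard
    have hle := h X (hXT.trans (erase_subset_erase _ (subset_univ _))) hX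
    have hXW : Submodule.span F (X : Set (Fin n → F)) ≤ W :=
      Submodule.span_le.2 fun x hx => by simpa [T] using mem_of_mem_erase (hXT hx)
    have := Submodule.finrank_mono hXW
    omega
  · refine fun hk => ⟨by simp, fun X hX hXk => ?_⟩
    by_contra! hlt
    let W : Submodule F (Fin n → F) := Submodule.span F (X : Set (Fin n → F))
    let T : Finset (Fin n → F) := (W : Set (Fin n → F)).toFinset
    have hT : T.card = Fintype.card F ^ Module.finrank F W := by
      rw [← Module.card_eq_pow_finrank, Set.toFinset_card]
      exact Fintype.card_congr (Equiv.refl _)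
    have hXT : X ⊆ T.erase 0 := fun x hx =>
      mem_erase.2 ⟨(mem_erase.1 (hX hx)).1, by simpa [T] using Submodule.subset_span hx⟩
    have hlt' : X.card < T.card :=
      (card_le_card hXT).trans_lt (card_erase_lt_of_mem (by simp [T]))
    have hpow : Fintype.card F ^ Module.finrank F W ≤ Fintype.card F ^ (ℓ - 1) :=
      Nat.pow_le_pow_right Fintype.card_pos (Nat.le_sub_one_of_lt hlt)
    omega

theorem IndKL.subset_univ_erase {F : Type*} [Field F] [Fintype F] [DecidableEq F] {n k ℓ : ℕ}
    {S : Finset (Fin n → F)} (hS : IndKL F n k ℓ S) : S ⊆ univ.erase 0 :=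
  fun _ hx => mem_erase.2 ⟨fun h0 => hS.1 (h0 ▸ hx), mem_univ _⟩

theorem indKL_empty {F : Type*} [Field F] {n k ℓ : ℕ} (hk : k ≠ 0) : IndKL F n k ℓ ∅ :=
  ⟨by simp, fun X hX hXk => by simp_all⟩

theorem indMax_eq_iff_indKL_univ_erase {F : Type*} [Field F] [Fintype F] [DecidableEq F]
    {n k ℓ : ℕ} (hk : k ≠ 0) :
    IndMax F n k ℓ = Fintype.card F ^ n - 1 ↔ IndKL F n k ℓ (univ.erase (0 : Fin n → F)) := by
  have hcard : (univ.erase (0 : Fin n → F)).card = Fintype.card F ^ n - 1 := by simp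
  have hub : Fintype.card F ^ n - 1 ∈
      upperBounds {m | ∃ S : Finset (Fin n → F), IndKL F n k ℓ S ∧ S.card = m} := by
    rintro _ ⟨S, hS, rfl⟩
    exact hcard ▸ card_le_card hS.subset_univ_erase
  constructor
  · intro h
    obtain ⟨S, hS, hSc⟩ := Nat.sSup_mem (s := {m | ∃ S, IndKL F n k ℓ S ∧ S.card = m})
      ⟨0, ∅, indKL_empty hk, card_empty⟩ ⟨_, hub⟩
    have hSeq : S = univ.erase 0 :=
      eq_of_subset_of_card_le hS.subset_univ_erase (by rw [hcard, hSc]; exact h.ge)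
    exact hSeq ▸ hS
  · intro h
    exact IsGreatest.csSup_eq ⟨⟨_, h, hcard⟩, hub⟩

theorem stmt11 (q : ℕ) (hq : IsPrimePow q) (F : Type*) [Field F] [Fintype F]
    [DecidableEq F] (hF : Fintype.card F = q) (n k ℓ : ℕ)
    (hℓ : 2 ≤ ℓ) (hℓk : ℓ ≤ k) (hk : k ≤ q ^ n - 1) (hℓn : ℓ ≤ n) :
    (IndMax F n k ℓ = q ^ n - 1 ↔ q ^ (ℓ - 1) ≤ k) ∧
    (IndKL F n k ℓ (Finset.univ.erase (0 : Fin n → F)) ↔ q ^ (ℓ - 1) ≤ k) := by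
  subst hF
  have h := indKL_univ_erase_iff (F := F) (k := k) (by omega : 1 ≤ ℓ) hℓn
  exact ⟨(indMax_eq_iff_indKL_univ_erase (by omega)).trans h, h⟩
end

section
/- Let q be a prime power, 𝔽_q a finite field with q elements, and 2 ≤ ℓ ≤ n. Then for every k with ℓ ≤ k ≤ q^{ℓ−1} − 1, one has Ind_q(n,k,ℓ) < Ind_q(n,k+1,ℓ); that is, the sequence {Ind_q(n,k,ℓ)}_{k=ℓ}^{q^{ℓ−1}} is strictly increasing in k. -/
open Finset

section

variable {F : Type*} [Field F] {n k ℓ : ℕ}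

/-- Adding one nonzero vector to a `(k,ℓ)`-independent set gives a `(k+1,ℓ)`-independent set. -/
theorem IndKL.insert [DecidableEq (Fin n → F)] {S : Finset (Fin n → F)} (hS : IndKL F n k ℓ S)
    {v : Fin n → F} (hv : v ≠ 0) : IndKL F n (k + 1) ℓ (insert v S) := by
  refine ⟨by simp [hS.1, hv.symm], fun X hX hXk => ?_⟩
  obtain ⟨Y, hYX, hYk⟩ := Finset.exists_subset_card_eq
    (show k ≤ (X.erase v).card by have := Finset.pred_card_le_card_erase (s := X) (a := v); omega)
  have hYS : Y ⊆ S := hYX.trans (Finset.subset_insert_iff.mp hX)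
  exact (hS.2 Y hYS hYk).trans (Submodule.finrank_mono
    (Submodule.span_mono (Finset.coe_subset.mpr (hYX.trans (Finset.erase_subset v X)))))

/-- If `k ≤ q^(ℓ-1) - 1`, a `(k,ℓ)`-independent set misses some nonzero vector. -/
theorem IndKL.exists_notMem [Fintype F] {S : Finset (Fin n → F)} (hS : IndKL F n k ℓ S)
    (hℓ : 1 ≤ ℓ) (hℓn : ℓ ≤ n) (hk : k ≤ Fintype.card F ^ (ℓ - 1) - 1) :
    ∃ v : Fin n → F, v ≠ 0 ∧ v ∉ S := by
  classical
  by_contra! hall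
  obtain ⟨W, hW⟩ : ∃ W : Submodule F (Fin n → F), Module.finrank F W = ℓ - 1 := by
    have hli := (Pi.basisFun F (Fin n)).linearIndependent.comp
      (Fin.castLE (show ℓ - 1 ≤ n by omega)) (Fin.castLE_injective _)
    exact ⟨_, (finrank_span_eq_card hli).trans (Fintype.card_fin _)⟩
  have hcard : (univ.filter (· ∈ W)).card = Fintype.card F ^ (ℓ - 1) := by
    rw [← hW, ← Module.card_eq_pow_finrank (K := F) (V := W), Fintype.card_subtype]
  obtain ⟨X, hXW, hXk⟩ := Finset.exists_subset_card_eq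
    (show k ≤ ((univ.filter (· ∈ W)).erase 0).card by
      rw [Finset.card_erase_of_mem (by simp), hcard]; exact hk)
  have hXS : X ⊆ S := fun v hv => hall v (Finset.ne_of_mem_erase (hXW hv))
  have hspan : Submodule.span F (X : Set (Fin n → F)) ≤ W := Submodule.span_le.mpr fun v hv =>
    (Finset.mem_filter.mp (Finset.mem_of_mem_erase (hXW hv))).2
  have h₁ := hS.2 X hXS hXk
  have h₂ := Submodule.finrank_mono hspan
  omega

theorem bddAbove_card_indKL (F : Type*) [Field F] [Fintype F] (n k ℓ : ℕ) :
    BddAbove {m | ∃ S : Finset (Fin n → F), IndKL F n k ℓ S ∧ S.card = m} := by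
  refine ⟨Fintype.card (Fin n → F), ?_⟩
  rintro _ ⟨S, -, rfl⟩
  exact S.card_le_univ

/-- The maximum defining `IndMax` is attained when `k` is positive. -/
theorem exists_indKL_card_eq_indMax (F : Type*) [Field F] [Fintype F] (n ℓ : ℕ) {k : ℕ}
    (hk : 0 < k) : ∃ S : Finset (Fin n → F), IndKL F n k ℓ S ∧ S.card = IndMax F n k ℓ := by
  have hne : {m | ∃ S : Finset (Fin n → F), IndKL F n k ℓ S ∧ S.card = m}.Nonempty := by
    refine ⟨0, ∅, ⟨Finset.notMem_empty _, fun X hX hXk => ?_⟩, rfl⟩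
    rw [Finset.subset_empty.mp hX, Finset.card_empty] at hXk
    omega
  exact Nat.sSup_mem hne (bddAbove_card_indKL F n k ℓ)

end

theorem stmt12 (q : ℕ) (hq : IsPrimePow q) (F : Type*) [Field F] [Fintype F]
    (hF : Fintype.card F = q) (n ℓ : ℕ) (hℓ : 2 ≤ ℓ) (hℓn : ℓ ≤ n) :
    ∀ k : ℕ, ℓ ≤ k → k ≤ q ^ (ℓ - 1) - 1 →
      IndMax F n k ℓ < IndMax F n (k + 1) ℓ := by
  classical
  intro k hℓk hkq
  obtain ⟨S, hS, hcard⟩ := exists_indKL_card_eq_indMax F n ℓ (show 0 < k by omega)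
  obtain ⟨v, hv, hvS⟩ := hS.exists_notMem (by omega) hℓn (hF ▸ hkq)
  rw [← hcard, ← Nat.succ_le_iff, Nat.succ_eq_add_one, ← Finset.card_insert_of_notMem hvS]
  exact le_csSup (bddAbove_card_indKL F n (k + 1) ℓ) ⟨_, hS.insert hv, rfl⟩
end

section
/- Let q be a prime power, 𝔽_q a finite field with q elements, and 2 ≤ ℓ ≤ k ≤ (q^n−1)/(q−1) with ℓ ≤ n. Then Ind_q^{pro}(n,k,ℓ) = (q^n−1)/(q−1) if and only if k > (q^{ℓ−1}−1)/(q−1). Equivalently, the whole projective space ℙ^{n−1}(𝔽_q) is (k,ℓ)-pro-independent if and only if k > (q^{ℓ−1}−1)/(q−1). -/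
open Finset

/-- A finite set `S` of points of the projective space `ℙ^{n-1}(F)` is
`(k,ℓ)`-pro-independent if every subset `X ⊆ S` of size `k` spans (as the span of
representative lines) a subspace of dimension at least `ℓ`. -/
def ProIndKL (F : Type*) [Field F] (n k ℓ : ℕ)
    (S : Finset (Projectivization F (Fin n → F))) : Prop :=
  ∀ X ⊆ S, X.card = k →
    ℓ ≤ Module.finrank F ↥(X.sup fun x => Projectivization.submodule x)

/-- `Ind_q^{pro}(n,k,ℓ)`: the maximum size of a `(k,ℓ)`-pro-independent subset of
`ℙ^{n-1}(F)`, where `F` is a field (with `q` elements). -/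
noncomputable def ProIndMax (F : Type*) [Field F] (n k ℓ : ℕ) : ℕ :=
  sSup {m | ∃ S : Finset (Projectivization F (Fin n → F)),
    ProIndKL F n k ℓ S ∧ S.card = m}

namespace Projectivization

variable {F V : Type*} [Field F] [AddCommGroup V] [Module F V]

lemma range_map_subtype (W : Submodule F V) :
    Set.range (map W.subtype W.subtype_injective) = {x : Projectivization F V | x.submodule ≤ W} := by
  ext x
  induction x using Projectivization.ind with
  | h v hv =>
    simp only [Set.mem_range, Set.mem_ofPred_eq, submodule_mk, Submodule.span_singleton_le_iff_mem]
    constructor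
    · rintro ⟨y, hy⟩
      induction y using Projectivization.ind with
      | h w hw =>
        rw [map_mk, mk_eq_mk_iff'] at hy
        obtain ⟨a, ha⟩ := hy
        have ha0 : a ≠ 0 := by
          rintro rfl
          exact hw (by simpa using ha.symm)
        rw [← W.smul_mem_iff ha0, ha]
        exact w.2
    · intro h
      exact ⟨mk F ⟨v, h⟩ (by simpa [Subtype.ext_iff] using hv), by simp [map_mk]⟩

/-- A finite-dimensional subspace of dimension `d` over a field with `q` elements
contains exactly `(q ^ d - 1) / (q - 1)` projective points. -/
lemma ncard_setOf_submodule_le [Finite F] (W : Submodule F V) [FiniteDimensional F W] :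
    {x : Projectivization F V | x.submodule ≤ W}.ncard =
      (Nat.card F ^ Module.finrank F W - 1) / (Nat.card F - 1) := by
  rw [← range_map_subtype, ← Set.image_univ,
    Set.ncard_image_of_injective _ (map_injective _ W.subtype_injective), Set.ncard_univ,
    card'', Module.natCard_eq_pow_finrank (K := F)]

end Projectivization

open Projectivization

section ProInd

variable {F : Type*} [Field F] {n k ℓ : ℕ}

lemma ProIndKL.subset {S T : Finset (Projectivization F (Fin n → F))}
    (hT : ProIndKL F n k ℓ T) (hST : S ⊆ T) : ProIndKL F n k ℓ S :=
  fun X hX => hT X (hX.trans hST)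

lemma proIndKL_of_lt [Finite F] (hk : (Nat.card F ^ (ℓ - 1) - 1) / (Nat.card F - 1) < k)
    (S : Finset (Projectivization F (Fin n → F))) : ProIndKL F n k ℓ S := by
  intro X _ hX
  by_contra! hlt
  have hsub : (X : Set (Projectivization F (Fin n → F))) ⊆
      {x | x.submodule ≤ X.sup fun x => x.submodule} :=
    fun x hx => Finset.le_sup (f := fun x => x.submodule) (Finset.mem_coe.mp hx)
  have hcard := Set.ncard_le_ncard hsub (Set.toFinite _)
  rw [Set.ncard_coe_finset, hX, ncard_setOf_submodule_le] at hcard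
  refine absurd (hk.trans_le hcard) (not_lt.mpr ?_)
  gcongr
  · exact Nat.card_pos
  · omega

lemma exists_not_proIndKL_of_le [Finite F] (hℓ : 1 ≤ ℓ) (hℓn : ℓ ≤ n)
    (hk : k ≤ (Nat.card F ^ (ℓ - 1) - 1) / (Nat.card F - 1)) :
    ∃ S : Finset (Projectivization F (Fin n → F)), ¬ ProIndKL F n k ℓ S := by
  obtain ⟨W, hW⟩ : ∃ W : Submodule F (Fin n → F), Module.finrank F W = ℓ - 1 := by
    obtain ⟨v, hv⟩ := exists_linearIndependent_of_le_finrank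
      (R := F) (M := Fin n → F) (n := ℓ - 1) (by rw [Module.finrank_fin_fun]; omega)
    exact ⟨_, by simpa using finrank_span_eq_card hv⟩
  rw [← hW, ← ncard_setOf_submodule_le] at hk
  obtain ⟨X, hXW, hX⟩ := Set.exists_subset_card_eq hk
  lift X to Finset (Projectivization F (Fin n → F)) using Set.toFinite X
  rw [Set.ncard_coe_finset] at hX
  refine ⟨X, fun h => ?_⟩
  have hle : (X.sup fun x => x.submodule) ≤ W :=
    Finset.sup_le fun x hx => hXW (Finset.mem_coe.mpr hx)
  have h1 := h X subset_rfl hX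
  have h2 := Submodule.finrank_mono hle
  omega

lemma forall_proIndKL_iff_lt [Finite F] (hℓ : 1 ≤ ℓ) (hℓn : ℓ ≤ n) :
    (∀ S : Finset (Projectivization F (Fin n → F)), ProIndKL F n k ℓ S) ↔
      (Nat.card F ^ (ℓ - 1) - 1) / (Nat.card F - 1) < k := by
  refine ⟨fun h => ?_, proIndKL_of_lt⟩
  by_contra! hk
  obtain ⟨S, hS⟩ := exists_not_proIndKL_of_le hℓ hℓn hk
  exact hS (h S)

/-- The maximum size of an independent set is the number of points of the whole space exactly
when every set of points is independent. -/
lemma proIndMax_eq_card_iff [Finite F] (hk : 0 < k) :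
    ProIndMax F n k ℓ = Nat.card (Projectivization F (Fin n → F)) ↔
      ∀ S : Finset (Projectivization F (Fin n → F)), ProIndKL F n k ℓ S := by
  have := Fintype.ofFinite (Projectivization F (Fin n → F))
  let A := {m | ∃ S : Finset (Projectivization F (Fin n → F)), ProIndKL F n k ℓ S ∧ S.card = m}
  have hbdd : ∀ m ∈ A, m ≤ Nat.card (Projectivization F (Fin n → F)) := by
    rintro _ ⟨S, -, rfl⟩
    rw [Nat.card_eq_fintype_card]
    exact S.card_le_univ
  constructor
  · intro h S
    have hempty : ProIndKL F n k ℓ ∅ := fun X hX hXk => by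
      rw [Finset.subset_empty.mp hX, Finset.card_empty] at hXk
      omega
    obtain ⟨T, hT, hcard⟩ := Nat.sSup_mem (s := A) ⟨0, ∅, hempty, rfl⟩ ⟨_, hbdd⟩
    obtain rfl : T = Finset.univ := by
      rw [← Finset.card_eq_iff_eq_univ, hcard, ← Nat.card_eq_fintype_card]
      exact h
    exact hT.subset (Finset.subset_univ S)
  · intro h
    exact IsGreatest.csSup_eq
      ⟨⟨Finset.univ, h _, by rw [Finset.card_univ, Nat.card_eq_fintype_card]⟩, hbdd⟩

end ProInd

theorem stmt14 (q : ℕ) (hq : IsPrimePow q) (F : Type*) [Field F] [Fintype F]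
    (hF : Fintype.card F = q) (n k ℓ : ℕ)
    (hℓ : 2 ≤ ℓ) (hℓk : ℓ ≤ k) (hk : k ≤ (q ^ n - 1) / (q - 1)) (hℓn : ℓ ≤ n) :
    (ProIndMax F n k ℓ = (q ^ n - 1) / (q - 1) ↔ (q ^ (ℓ - 1) - 1) / (q - 1) < k) ∧
    ((∀ S : Finset (Projectivization F (Fin n → F)), ProIndKL F n k ℓ S) ↔
      (q ^ (ℓ - 1) - 1) / (q - 1) < k) := by
  have hall := forall_proIndKL_iff_lt (F := F) (k := k) (by omega : 1 ≤ ℓ) hℓn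
  have hcard : Nat.card (Projectivization F (Fin n → F)) = (q ^ n - 1) / (q - 1) := by
    rw [card'', Module.natCard_eq_pow_finrank (K := F), Module.finrank_fin_fun,
      Nat.card_eq_fintype_card, hF]
  rw [Nat.card_eq_fintype_card, hF] at hall
  refine ⟨?_, hall⟩
  rw [← hcard, proIndMax_eq_card_iff (by omega), hall]
end

section
/- Let q be a prime power, 𝔽_q a finite field with q elements, and 2 ≤ ℓ ≤ n. Then for every k with ℓ ≤ k ≤ (q^{ℓ−1}−1)/(q−1) − 1, one has Ind_q^{pro}(n,k,ℓ) < Ind_q^{pro}(n,k+1,ℓ); that is, the sequence {Ind_q^{pro}(n,k,ℓ)}_{k=ℓ}^{(q^{ℓ−1}−1)/(q−1)} is strictly increasing in k. -/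
open Finset

theorem ProIndKL.insert_succ {F : Type*} [Field F] {n k ℓ : ℕ}
    [DecidableEq (Projectivization F (Fin n → F))]
    {S : Finset (Projectivization F (Fin n → F))} (hS : ProIndKL F n k ℓ S)
    (p : Projectivization F (Fin n → F)) : ProIndKL F n (k + 1) ℓ (insert p S) := by
  intro X hX hXk
  obtain ⟨Y, hY, hYk⟩ : ∃ Y ⊆ X.erase p, Y.card = k :=
    Finset.exists_subset_card_eq (by have := Finset.pred_card_le_card_erase (s := X) (a := p); lia)
  have hYS : Y ⊆ S := hY.trans (Finset.subset_insert_iff.mp hX)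
  exact (hS Y hYS hYk).trans
    (Submodule.finrank_mono (Finset.sup_mono (hY.trans (Finset.erase_subset p X))))

theorem Projectivization.submodule_map_le_range {F V W : Type*} [Field F]
    [AddCommGroup V] [Module F V] [AddCommGroup W] [Module F W]
    (f : V →ₗ[F] W) (hf : Function.Injective f) (x : Projectivization F V) :
    (Projectivization.map f hf x).submodule ≤ LinearMap.range f := by
  induction x using Projectivization.ind with
  | h v hv =>
    rw [Projectivization.map_mk, Projectivization.submodule_mk, Submodule.span_singleton_le_iff_mem]
    exact LinearMap.mem_range_self f v

theorem not_proIndKL_of_forall_mem {F : Type*} [Field F] [Finite F] {n k ℓ : ℕ}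
    (hℓ : 0 < ℓ) (hℓn : ℓ ≤ n) (hk : k ≤ ∑ i ∈ range (ℓ - 1), Nat.card F ^ i)
    {S : Finset (Projectivization F (Fin n → F))} (hS : ∀ x, x ∈ S) :
    ¬ ProIndKL F n k ℓ S := by
  classical
  intro h
  have hle : ℓ - 1 ≤ n := by lia
  obtain ⟨f, hf⟩ : ∃ f : (Fin (ℓ - 1) → F) →ₗ[F] (Fin n → F), Function.Injective f :=
    ⟨Function.ExtendByZero.linearMap F (Fin.castLE hle), fun a b hab => funext fun i => by
      simpa [(Fin.castLE_injective hle).extend_apply] using congrFun hab (Fin.castLE hle i)⟩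
  have : Fintype (Projectivization F (Fin (ℓ - 1) → F)) := Fintype.ofFinite _
  obtain ⟨T, -, hT⟩ : ∃ T ⊆ (univ : Finset (Projectivization F (Fin (ℓ - 1) → F))), T.card = k := by
    refine Finset.exists_subset_card_eq ?_
    rwa [Finset.card_univ, Fintype.card_eq_nat_card,
      Projectivization.card_of_finrank F _ (Module.finrank_fin_fun F)]
  have hspan := h (T.image (Projectivization.map f hf)) (fun x _ => hS x)
    (by rw [Finset.card_image_of_injective _ (Projectivization.map_injective f hf), hT])
  have hsup : ((T.image (Projectivization.map f hf)).sup fun x => Projectivization.submodule x)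
      ≤ LinearMap.range f := by
    refine Finset.sup_le fun x hx => ?_
    obtain ⟨y, -, rfl⟩ := Finset.mem_image.mp hx
    exact Projectivization.submodule_map_le_range f hf y
  have hrank := (Submodule.finrank_mono hsup).trans (LinearMap.finrank_range_le f)
  rw [Module.finrank_fin_fun] at hrank
  lia

theorem bddAbove_card_proIndKL (F : Type*) [Field F] [Finite F] (n k ℓ : ℕ) :
    BddAbove {m | ∃ S : Finset (Projectivization F (Fin n → F)),
      ProIndKL F n k ℓ S ∧ S.card = m} := by
  have : Fintype (Projectivization F (Fin n → F)) := Fintype.ofFinite _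
  refine ⟨Fintype.card (Projectivization F (Fin n → F)), ?_⟩
  rintro m ⟨S, -, rfl⟩
  exact Finset.card_le_univ S

theorem exists_proIndKL_card_eq_proIndMax (F : Type*) [Field F] [Finite F] {n k : ℕ} (ℓ : ℕ)
    (hk : k ≠ 0) :
    ∃ S : Finset (Projectivization F (Fin n → F)),
      ProIndKL F n k ℓ S ∧ S.card = ProIndMax F n k ℓ := by
  refine Nat.sSup_mem (s := {m | ∃ S : Finset (Projectivization F (Fin n → F)),
    ProIndKL F n k ℓ S ∧ S.card = m}) ⟨0, ∅, fun X hX hXk => ?_, rfl⟩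
    (bddAbove_card_proIndKL F n k ℓ)
  rw [Finset.subset_empty.mp hX, Finset.card_empty] at hXk
  exact absurd hXk.symm hk

theorem stmt15 (q : ℕ) (hq : IsPrimePow q) (F : Type*) [Field F] [Fintype F]
    (hF : Fintype.card F = q) (n ℓ : ℕ) (hℓ : 2 ≤ ℓ) (hℓn : ℓ ≤ n) :
    ∀ k : ℕ, ℓ ≤ k → k ≤ (q ^ (ℓ - 1) - 1) / (q - 1) - 1 →
      ProIndMax F n k ℓ < ProIndMax F n (k + 1) ℓ := by
  classical
  intro k hℓk hk
  obtain ⟨S, hS, hScard⟩ := exists_proIndKL_card_eq_proIndMax F (n := n) (k := k) ℓ (by lia)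
  have hk' : k ≤ ∑ i ∈ range (ℓ - 1), Nat.card F ^ i := by
    rw [← Fintype.card_eq_nat_card, hF, Nat.geomSum_eq hq.one_lt]
    exact hk.trans (Nat.sub_le _ _)
  obtain ⟨p, hp⟩ : ∃ p, p ∉ S := by
    by_contra! hall
    exact not_proIndKL_of_forall_mem (by lia) hℓn hk' hall hS
  rw [← hScard, ← Nat.succ_le_iff, Nat.succ_eq_add_one, ← Finset.card_insert_of_notMem hp]
  exact le_csSup (bddAbove_card_proIndKL F n (k + 1) ℓ) ⟨_, hS.insert_succ p, rfl⟩
end
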